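/- arXiv:1901.02657 — 2 statements merged into one kernel-verified Lean document; each statement's English description precedes it below -/
import Mathlib

section
/- Let Γ be a countably infinite discrete group acting on a compact metrizable space X by homeomorphisms, and let 𝒜 be a finite family of tuples of subsets of X with positive independence density. Then every splitting of 𝒜 has positive independence density. -/
/-- A (finite) tuple of subsets of `X`: a length `k` together with `k` subsets. -/
abbrev DynTuple (X : Type*) := Σ k : ℕ, Fin k → Set X

/-- `J ⊆ Γ` is an independence set for a tuple `A = (A_i)_{i : ι}` of subsets of `X` if
for every nonempty finite `F ⊆ J` and every map `ω : F → ι`, the intersection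
`⋂_{s ∈ F} s⁻¹ A_{ω(s)}` is nonempty. -/
def IsIndepSet {Γ : Type*} [Group Γ] {X : Type*} [MulAction Γ X] {ι : Type*}
    (A : ι → Set X) (J : Set Γ) : Prop :=
  ∀ F : Finset Γ, (F : Set Γ) ⊆ J → F.Nonempty → ∀ ω : Γ → ι,
    (⋂ s ∈ F, (fun x : X => s • x) ⁻¹' A (ω s)).Nonempty

/-- A finite family `𝒜` of tuples of subsets of `X` has positive independence density
if there is some `q > 0` such that for every nonempty finite `F ⊆ Γ` there are `J ⊆ F`
with `|J| ≥ q|F|` and some `A ∈ 𝒜` such that `J` is an independence set for `A`. -/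
def HasPosIndepDensity (Γ : Type*) [Group Γ] {X : Type*} [MulAction Γ X]
    (𝒜 : Finset (DynTuple X)) : Prop :=
  ∃ q : ℝ, 0 < q ∧ ∀ F : Finset Γ, F.Nonempty →
    ∃ J : Finset Γ, J ⊆ F ∧ q * (F.card : ℝ) ≤ (J.card : ℝ) ∧
      ∃ A ∈ 𝒜, IsIndepSet A.2 (J : Set Γ)

/-- `𝒜'` is a simple splitting of `𝒜` if it is obtained from `𝒜` by choosing a tuple
`A ∈ 𝒜`, an index `j` and a decomposition `A j = B₁ ∪ B₂` of the `j`-th entry, and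
replacing `A` by the two tuples obtained by replacing the `j`-th entry of `A` with `B₁`
and with `B₂` respectively. -/
def SimpleSplitting {X : Type*} (𝒜 𝒜' : Finset (DynTuple X)) : Prop :=
  ∃ (A : DynTuple X) (_ : A ∈ 𝒜) (j : Fin A.1) (B₁ B₂ : Set X),
    A.2 j = B₁ ∪ B₂ ∧
    letI : DecidableEq (DynTuple X) := Classical.decEq _
    𝒜' = insert ⟨A.1, Function.update A.2 j B₁⟩
          (insert ⟨A.1, Function.update A.2 j B₂⟩ (𝒜.erase A))

/-- A set `I` of coordinates, given by its indicator, is shattered by a set `S` of partial words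
if every total word agrees on `I` with some element of `S`. -/
def Shatters {n : ℕ} {κ : Type*} (S : Set (Fin n → Option κ)) (I : Fin n → Bool) : Prop :=
  ∀ ω : Fin n → κ, ∃ σ ∈ S, ∀ i, I i = true → σ i = some (ω i)

theorem sum_fin_succ_pi {n : ℕ} {α M : Type*} [Fintype α] [AddCommMonoid M]
    (f : (Fin (n + 1) → α) → M) :
    ∑ σ, f σ = ∑ a, ∑ σ : Fin n → α, f (Fin.cons a σ) := by
  rw [← (Fin.consEquiv fun _ : Fin (n + 1) => α).sum_comp, Fintype.sum_prod_type]
  rfl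

open Classical in
/-- A weighted Sauer–Shelah inequality for partial words. -/
theorem sum_weight_le_sum_shatters {κ : Type*} [Fintype κ] [Nonempty κ] {w : ℝ} (hw : 0 ≤ w)
    (n : ℕ) (S : Set (Fin n → Option κ)) :
    ∑ σ, (if σ ∈ S then ∏ i, (σ i).elim w (fun _ => 1) else 0) ≤
      ∑ I, if Shatters S I then ∏ i, (if I i then 1 else (Fintype.card κ - 1 + w)) else 0 := by
  have hcard : (1 : ℝ) ≤ Fintype.card κ := by exact_mod_cast Fintype.card_pos
  induction n with
  | zero =>
    simp only [Fintype.sum_unique, Finset.univ_eq_empty, Finset.prod_empty]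
    split_ifs with h h'
    · exact le_rfl
    · exact absurd (fun ω => ⟨_, h, fun i => i.elim0⟩) h'
    · exact zero_le_one
    · exact le_rfl
  | succ n ih =>
    set u : ℝ := Fintype.card κ - 1 + w with hu
    have hu0 : 0 ≤ u := by linarith
    let T : Option κ → Set (Fin n → Option κ) := fun a => {σ | Fin.cons a σ ∈ S}
    let wt : Option κ → ℝ := fun a => a.elim w fun _ => 1
    have hwt : ∀ a, 0 ≤ wt a := by rintro (_ | a) <;> simp [wt, hw]
    have htot : ∑ a, wt a = u + 1 := by
      simp [wt, Fintype.sum_option, hu]; ring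
    have hmiss : ∀ p : Option κ → Prop, ∀ a : κ, ¬ p (some a) →
        ∑ a, wt a * (if p a then 1 else 0) ≤ u := by
      intro p a ha
      have h1 : ∑ b, wt b * (if p b then 1 else 0) ≤ ∑ b, (wt b - if b = some a then 1 else 0) := by
        refine Finset.sum_le_sum fun b _ => ?_
        by_cases hb : b = some a
        · subst hb; simp [ha, wt]
        · simp only [hb, if_false, sub_zero]
          split_ifs <;> simp [hwt b]
      rw [Finset.sum_sub_distrib, htot] at h1
      simpa using h1
    let g : (Fin n → Bool) → ℝ := fun I => ∏ i, (if I i then 1 else u)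
    have hg : ∀ I, 0 ≤ g I := fun I => Finset.prod_nonneg fun i _ => by split_ifs <;> simp [hu0]
    have hfalse : ∀ I a, Shatters (T a) I → Shatters S (Fin.cons false I) := by
      intro I a h ω
      obtain ⟨σ, hσ, hσ'⟩ := h (Fin.tail ω)
      refine ⟨Fin.cons a σ, hσ, fun i => ?_⟩
      refine Fin.cases ?_ (fun i => ?_) i
      · simp
      · simpa [Fin.tail] using hσ' i
    have htrue : ∀ I, (∀ a, Shatters (T (some a)) I) → Shatters S (Fin.cons true I) := by
      intro I h ω
      obtain ⟨σ, hσ, hσ'⟩ := h (ω 0) (Fin.tail ω)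
      refine ⟨Fin.cons (some (ω 0)) σ, hσ, fun i => ?_⟩
      refine Fin.cases ?_ (fun i => ?_) i
      · simp
      · simpa [Fin.tail] using hσ' i
    have hpoint : ∀ I, ∑ a, wt a * (if Shatters (T a) I then 1 else 0) ≤
        (if Shatters S (Fin.cons true I) then 1 else 0) +
          (if Shatters S (Fin.cons false I) then u else 0) := by
      intro I
      by_cases hall : ∀ a, Shatters (T (some a)) I
      · rw [if_pos (htrue I hall), if_pos (hfalse I _ (hall (Classical.arbitrary κ))), add_comm,
          ← htot]
        refine Finset.sum_le_sum fun b _ => ?_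
        split_ifs <;> simp [hwt b]
      · obtain ⟨a, ha⟩ := not_forall.mp hall
        by_cases hsome : ∃ b, Shatters (T b) I
        · obtain ⟨b, hb⟩ := hsome
          rw [if_pos (hfalse I b hb)]
          have := hmiss (fun b => Shatters (T b) I) a ha
          split_ifs <;> linarith
        · push Not at hsome
          simp only [hsome, if_false, mul_zero, Finset.sum_const_zero]
          split_ifs <;> linarith
    calc ∑ σ, (if σ ∈ S then ∏ i, (σ i).elim w (fun _ => 1) else 0)
        = ∑ a, wt a * ∑ σ, (if σ ∈ T a then ∏ i, (σ i).elim w (fun _ => 1) else 0) := by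
          rw [sum_fin_succ_pi]
          refine Finset.sum_congr rfl fun a _ => ?_
          rw [Finset.mul_sum]
          refine Finset.sum_congr rfl fun σ _ => ?_
          simp [Fin.prod_univ_succ, T, wt]
      _ ≤ ∑ a, wt a * ∑ I, (if Shatters (T a) I then g I else 0) :=
          Finset.sum_le_sum fun a _ => mul_le_mul_of_nonneg_left (ih (T a)) (hwt a)
      _ = ∑ I, g I * ∑ a, wt a * (if Shatters (T a) I then 1 else 0) := by
          simp only [Finset.mul_sum]
          rw [Finset.sum_comm]
          refine Finset.sum_congr rfl fun I _ => Finset.sum_congr rfl fun a _ => ?_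
          split_ifs <;> ring
      _ ≤ ∑ I, g I * ((if Shatters S (Fin.cons true I) then 1 else 0) +
            (if Shatters S (Fin.cons false I) then u else 0)) :=
          Finset.sum_le_sum fun I _ => mul_le_mul_of_nonneg_left (hpoint I) (hg I)
      _ = _ := by
          rw [sum_fin_succ_pi, Fintype.sum_bool, ← Finset.sum_add_distrib]
          refine Finset.sum_congr rfl fun I _ => ?_
          simp only [Fin.prod_univ_succ, Fin.cons_zero, Fin.cons_succ, g, Bool.false_eq_true,
            if_false, if_true, one_mul, mul_add, mul_ite, mul_one, mul_zero, mul_comm u]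

open Classical in
/-- A set of partial words of large total weight shatters a set of coordinates of
proportional size. -/
theorem exists_shatters_of_weight (κ : Type*) [Fintype κ] [Nonempty κ] :
    ∃ c : ℝ, 0 < c ∧ ∀ (n : ℕ) (S : Set (Fin n → Option κ)),
      (Fintype.card κ - 1 / 2 : ℝ) ^ n ≤
        ∑ σ, (if σ ∈ S then ∏ i, (σ i).elim (1 / 4 : ℝ) (fun _ => 1) else 0) →
      ∃ I, Shatters S I ∧ c * n ≤ (Finset.univ.filter fun i => I i = true).card := by
  have hcard : (1 : ℝ) ≤ Fintype.card κ := by exact_mod_cast Fintype.card_pos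
  obtain ⟨K, hKdef⟩ : ∃ K : ℝ, K = Fintype.card κ := ⟨_, rfl⟩
  rw [← hKdef] at hcard ⊢
  have hK : 0 < K - 1 / 2 := by linarith
  set ρ : ℝ := (K - 5 / 8) / (K - 1 / 2) with hρ
  have hρ0 : 0 < ρ := div_pos (by linarith) hK
  have hρ1 : ρ < 1 := by
    rw [hρ, div_lt_one hK]; linarith
  have hlog : Real.log (1 / 8) < 0 := Real.log_neg (by norm_num) (by norm_num)
  refine ⟨Real.log ρ / Real.log (1 / 8), div_pos_of_neg_of_neg (Real.log_neg hρ0 hρ1) hlog,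
    fun n S hS => ?_⟩
  by_contra! hcon
  have hle := hS.trans (sum_weight_le_sum_shatters (by norm_num) n S)
  rw [← hKdef, ← Finset.sum_filter] at hle
  set H := Finset.univ.filter fun I => Shatters S I
  have hpow : ∀ I ∈ H, ρ ^ n < (1 / 8) ^ (Finset.univ.filter fun i => I i = true).card := by
    intro I hI
    have h := hcon I (Finset.mem_filter.mp hI).2
    rw [div_mul_eq_mul_div, lt_div_iff_of_neg hlog] at h
    rw [← Real.log_lt_log_iff (by positivity) (by positivity), Real.log_pow, Real.log_pow]
    linarith
  have hH : H.Nonempty := by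
    by_contra h
    rw [Finset.not_nonempty_iff_eq_empty.mp h, Finset.sum_empty] at hle
    exact (pow_pos hK n).not_ge hle
  have hu : 0 < K - 1 + 1 / 4 := by linarith
  have hterm : ∀ I ∈ H, ρ ^ n * ∏ i, (if I i then 1 else K - 1 + 1 / 4) <
      ∏ i, (if I i then 1 / 8 else K - 1 + 1 / 4) := by
    intro I hI
    have hpos : 0 < ∏ i, (if I i then 1 else K - 1 + 1 / 4) :=
      Finset.prod_pos fun i _ => by split_ifs <;> linarith
    refine (mul_lt_mul_of_pos_right (hpow I hI) hpos).trans_eq ?_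
    rw [← Finset.prod_const, Finset.prod_filter, ← Finset.prod_mul_distrib]
    exact Finset.prod_congr rfl fun i _ => by split_ifs <;> simp
  have hlt := Finset.sum_lt_sum_of_nonempty hH hterm
  have hfull : ∑ I ∈ H, ∏ i, (if I i then 1 / 8 else K - 1 + 1 / 4) ≤ (K - 5 / 8) ^ n := by
    refine (Finset.sum_le_univ_sum_of_nonneg fun I => Finset.prod_nonneg fun i _ => ?_).trans_eq ?_
    · split_ifs <;> linarith
    · rw [← Fintype.piFinset_univ, ← Finset.prod_univ_sum (fun _ => Finset.univ)
        (fun (_ : Fin n) (b : Bool) => if b then 1 / 8 else K - 1 + 1 / 4)]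
      simp only [Fintype.sum_bool, if_true, Bool.false_eq_true, if_false, Finset.prod_const,
        Finset.card_univ, Fintype.card_fin]
      congr 1; ring
  rw [← Finset.mul_sum] at hlt
  have h3 := mul_le_mul_of_nonneg_left hle (pow_pos hρ0 n).le
  rw [← mul_pow, hρ, div_mul_cancel₀ _ hK.ne', ← hρ] at h3
  linarith

open Classical in
/-- If every total word has the occurrences of the letter `j` coloured by two colours, then on a
set of coordinates of proportional size, all patterns are realized with a single colour. -/
theorem exists_monochromatic_patterns {κ : Type*} [Fintype κ] (j : κ) :
    ∃ c : ℝ, 0 < c ∧ ∀ (n : ℕ) (P : (Fin n → κ) → Fin n → Prop),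
      ∃ I : Finset (Fin n), c * n ≤ I.card ∧
        ((∀ ω : Fin n → κ, ∃ η : Fin n → κ, ∀ i ∈ I, η i = ω i ∧ (ω i = j → P η i)) ∨
          (∀ ω : Fin n → κ, ∃ η : Fin n → κ, ∀ i ∈ I, η i = ω i ∧ (ω i = j → ¬ P η i))) := by
  have : Nonempty κ := ⟨j⟩
  obtain ⟨c, hc, hmain⟩ := exists_shatters_of_weight κ
  refine ⟨c, hc, fun n P => ?_⟩
  let mask (Q : (Fin n → κ) → Fin n → Prop) (η : Fin n → κ) (i : Fin n) : Option κ :=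
    if η i = j ∧ ¬ Q η i then none else some (η i)
  have hpattern : ∀ Q I, Shatters (Set.range (mask Q)) I →
      ∀ ω : Fin n → κ, ∃ η : Fin n → κ, ∀ i ∈ Finset.univ.filter (fun i => I i = true),
        η i = ω i ∧ (ω i = j → Q η i) := by
    intro Q I h ω
    obtain ⟨_, ⟨η, rfl⟩, hη⟩ := h ω
    refine ⟨η, fun i hi => ?_⟩
    have := hη i (Finset.mem_filter.mp hi).2
    simp only [mask] at this
    split_ifs at this with h'
    have he := Option.some_injective _ this
    exact ⟨he, fun hj => by_contra fun hQ => h' ⟨he.trans hj, hQ⟩⟩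
  let weight (σ : Fin n → Option κ) : ℝ := ∏ i, (σ i).elim (1 / 4 : ℝ) (fun _ => 1)
  have hsum : ∀ Q, ∑ σ, (if σ ∈ Set.range (mask Q) then weight σ else 0) =
      ∑ η, weight (mask Q η) := by
    intro Q
    have hinj : Function.Injective (mask Q) := by
      intro η η' h
      funext i
      have hi := congrFun h i
      simp only [mask] at hi
      split_ifs at hi with h1 h2
      · exact h1.1.trans h2.1.symm
      · exact Option.some_injective _ hi
    rw [← Finset.sum_filter, ← Finset.sum_image (f := weight) hinj.injOn]
    refine Finset.sum_congr ?_ fun _ _ => rfl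
    ext σ; simp
  have hamgm : ∀ η, 2 * ∏ i, (if η i = j then 1 / 2 else 1) ≤
      weight (mask P η) + weight (mask (fun η i => ¬ P η i) η) := by
    intro η
    have hprod : weight (mask P η) * weight (mask (fun η i => ¬ P η i) η) =
        (∏ i, (if η i = j then 1 / 2 else 1)) ^ 2 := by
      simp only [weight, mask]
      rw [← Finset.prod_mul_distrib, ← Finset.prod_pow]
      refine Finset.prod_congr rfl fun i _ => ?_
      by_cases h1 : η i = j <;> by_cases h2 : P η i <;> simp [h1, h2] <;> norm_num
    have hnonneg : ∀ σ, 0 ≤ weight σ := fun σ => Finset.prod_nonneg fun i _ => by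
      cases σ i <;> simp
    refine le_of_sq_le_sq ?_ (add_nonneg (hnonneg _) (hnonneg _))
    nlinarith [sq_nonneg (weight (mask P η) - weight (mask (fun η i => ¬ P η i) η))]
  have htotal : ∑ η : Fin n → κ, ∏ i, (if η i = j then 1 / 2 else 1 : ℝ) =
      (Fintype.card κ - 1 / 2) ^ n := by
    rw [← Fintype.piFinset_univ, ← Finset.prod_univ_sum (fun _ => Finset.univ)
      (fun (_ : Fin n) (b : κ) => (if b = j then 1 / 2 else 1 : ℝ))]
    have : ∑ b, (if b = j then 1 / 2 else 1 : ℝ) = Fintype.card κ - 1 / 2 := by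
      have h : ∀ b, (if b = j then 1 / 2 else 1 : ℝ) = 1 - if b = j then 1 / 2 else 0 := by
        intro b; split_ifs <;> norm_num
      rw [Finset.sum_congr rfl fun b _ => h b, Finset.sum_sub_distrib]
      simp
    rw [this, Finset.prod_const, Finset.card_univ, Fintype.card_fin]
  have hboth := Finset.sum_le_sum fun η (_ : η ∈ Finset.univ) => hamgm η
  rw [← Finset.mul_sum, htotal, Finset.sum_add_distrib, ← hsum, ← hsum] at hboth
  have hor : ∀ Q, (Fintype.card κ - 1 / 2 : ℝ) ^ n ≤
      ∑ σ, (if σ ∈ Set.range (mask Q) then weight σ else 0) →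
      ∃ I : Finset (Fin n), c * n ≤ I.card ∧
        ∀ ω : Fin n → κ, ∃ η : Fin n → κ, ∀ i ∈ I, η i = ω i ∧ (ω i = j → Q η i) := by
    intro Q hQ
    obtain ⟨I, hI, hIc⟩ := hmain n (Set.range (mask Q)) (by convert hQ)
    exact ⟨_, hIc, hpattern Q I hI⟩
  rcases le_or_gt ((Fintype.card κ - 1 / 2 : ℝ) ^ n)
    (∑ σ, (if σ ∈ Set.range (mask P) then weight σ else 0)) with h | h
  · obtain ⟨I, hI, h⟩ := hor P h
    exact ⟨I, hI, Or.inl h⟩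
  · obtain ⟨I, hI, h⟩ := hor (fun η i => ¬ P η i) (by linarith)
    exact ⟨I, hI, Or.inr h⟩

/-- When one entry of a tuple is decomposed into two parts, every finite independence set contains
one of proportional size for one of the two resulting tuples. -/
theorem exists_isIndepSet_update (Γ : Type*) [Group Γ] {X : Type*} [MulAction Γ X]
    {κ : Type*} [Fintype κ] [DecidableEq κ] (A : κ → Set X) (j : κ) (B₁ B₂ : Set X)
    (hB : A j = B₁ ∪ B₂) :
    ∃ c : ℝ, 0 < c ∧ ∀ J : Finset Γ, IsIndepSet A (J : Set Γ) →
      ∃ I ⊆ J, c * J.card ≤ I.card ∧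
        (IsIndepSet (Function.update A j B₁) (I : Set Γ) ∨
          IsIndepSet (Function.update A j B₂) (I : Set Γ)) := by
  classical
  obtain ⟨c, hc, hmain⟩ := exists_monochromatic_patterns j
  refine ⟨c, hc, fun J hJ => ?_⟩
  rcases J.eq_empty_or_nonempty with rfl | hne
  · refine ⟨∅, le_rfl, by simp, Or.inl fun F hF hF' => ?_⟩
    obtain ⟨s, hs⟩ := hF'
    simpa using hF hs
  let e := J.equivFin
  have hx : ∀ η : Fin J.card → κ, ∃ x : X, ∀ i, ((e.symm i : Γ) • x) ∈ A (η i) := by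
    intro η
    obtain ⟨x, hx⟩ := hJ J subset_rfl hne fun s => if h : s ∈ J then η (e ⟨s, h⟩) else j
    refine ⟨x, fun i => ?_⟩
    simpa using Set.mem_iInter₂.mp hx (e.symm i) (e.symm i).2
  choose x hx using hx
  obtain ⟨I, hI, hor⟩ := hmain J.card fun η i => ((e.symm i : Γ) • x η) ∈ B₁
  let f : Fin J.card ↪ Γ := e.symm.toEmbedding.trans (Function.Embedding.subtype _)
  have hindep : ∀ B : Set X, (∀ ω : Fin J.card → κ, ∃ η, ∀ i ∈ I, η i = ω i ∧
      (ω i = j → ((e.symm i : Γ) • x η) ∈ B)) →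
      IsIndepSet (Function.update A j B) (I.map f : Set Γ) := by
    intro B h F hF _ ω
    obtain ⟨η, hη⟩ := h fun i => ω (e.symm i)
    refine ⟨x η, Set.mem_iInter₂.mpr fun s hs => ?_⟩
    obtain ⟨i, hi, rfl⟩ := Finset.mem_map.mp (hF hs)
    obtain ⟨h1, h2⟩ := hη i hi
    change (e.symm i : Γ) • x η ∈ Function.update A j B (ω (e.symm i))
    by_cases hj : ω (e.symm i) = j
    · rw [hj, Function.update_self]
      exact h2 hj
    · rw [Function.update_of_ne hj, ← h1]
      exact hx η i
  refine ⟨I.map f, fun s hs => ?_, by rwa [Finset.card_map], hor.imp (hindep B₁) fun h =>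
    hindep B₂ fun ω => ?_⟩
  · obtain ⟨i, -, rfl⟩ := Finset.mem_map.mp hs
    exact (e.symm i).2
  · obtain ⟨η, hη⟩ := h ω
    refine ⟨η, fun i hi => ⟨(hη i hi).1, fun hj => ?_⟩⟩
    have hmem := hx η i
    rw [(hη i hi).1, hj, hB] at hmem
    exact hmem.resolve_left ((hη i hi).2 hj)

theorem HasPosIndepDensity.of_simpleSplitting {Γ : Type*} [Group Γ] {X : Type*} [MulAction Γ X]
    {𝒜 𝒜' : Finset (DynTuple X)} (h : HasPosIndepDensity Γ 𝒜) (hs : SimpleSplitting 𝒜 𝒜') :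
    HasPosIndepDensity Γ 𝒜' := by
  classical
  obtain ⟨A, -, j, B₁, B₂, hB, h𝒜'⟩ := hs
  obtain ⟨q, hq, hF⟩ := h
  obtain ⟨c, hc, hsplit⟩ := exists_isIndepSet_update Γ A.2 j B₁ B₂ hB
  refine ⟨min q (c * q), lt_min hq (mul_pos hc hq), fun F hne => ?_⟩
  obtain ⟨J, hJF, hJ, A', hA', hind⟩ := hF F hne
  by_cases hAA : A' = A
  · subst hAA
    obtain ⟨I, hIJ, hI, hor⟩ := hsplit J hind
    refine ⟨I, hIJ.trans hJF, ?_, ?_⟩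
    · calc min q (c * q) * (F.card : ℝ) ≤ c * q * F.card := by gcongr; exact min_le_right _ _
        _ = c * (q * F.card) := mul_assoc _ _ _
        _ ≤ c * J.card := by gcongr
        _ ≤ I.card := hI
    · rcases hor with h | h
      · exact ⟨⟨A'.1, Function.update A'.2 j B₁⟩, by rw [h𝒜']; simp, h⟩
      · exact ⟨⟨A'.1, Function.update A'.2 j B₂⟩, by rw [h𝒜']; simp, h⟩
  · refine ⟨J, hJF, le_trans ?_ hJ, A', ?_, hind⟩
    · gcongr; exact min_le_left _ _
    · rw [h𝒜']; simp [hAA, hA']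

/-- For a continuous action of a countably infinite group `Γ` on a compact metrizable
space `X`, if a finite family `𝒜` of tuples of subsets of `X` has positive independence
density, then every splitting of `𝒜` (obtained by finitely many successive simple
splittings) has positive independence density. -/
theorem splitting_preserves_pos_indep_density
    {Γ : Type*} [Group Γ] [Countable Γ] [Infinite Γ]
    {X : Type*} [TopologicalSpace X] [CompactSpace X] [TopologicalSpace.MetrizableSpace X]
    [MulAction Γ X] [ContinuousConstSMul Γ X]
    (𝒜 𝒜' : Finset (DynTuple X))
    (h : HasPosIndepDensity Γ 𝒜)
    (hsplit : Relation.ReflTransGen SimpleSplitting 𝒜 𝒜') :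
    HasPosIndepDensity Γ 𝒜' := by
  induction hsplit with
  | refl => exact h
  | tail _ hs ih => exact ih.of_simpleSplitting hs
end

section
/- Let Γ be a countably infinite discrete group acting on (ℝ/ℤ)^Γ by the left shift (sx)_t = x_{s⁻¹t}. Then the naive topological entropy h^nv(Γ↷(ℝ/ℤ)^Γ) is positive. -/
open scoped ENNReal NNReal

/-- A finite open cover of `X`, encoded as a `Finset` of open sets whose union is `X`. -/
def IsFinOpenCover {X : Type*} [TopologicalSpace X] (𝒰 : Finset (Set X)) : Prop :=
  (∀ U ∈ 𝒰, IsOpen U) ∧ ⋃₀ (𝒰 : Set (Set X)) = Set.univ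

/-- `N(𝒰)`: the minimal cardinality of a subcover of `𝒰`. -/
noncomputable def coverNum {X : Type*} (𝒰 : Finset (Set X)) : ℕ :=
  sInf {n | ∃ 𝒱 : Finset (Set X), 𝒱 ⊆ 𝒰 ∧ ⋃₀ (𝒱 : Set (Set X)) = Set.univ ∧ 𝒱.card = n}

/-- `𝒰^F = ⋁_{s ∈ F} s⁻¹𝒰` for the action `σ : Γ → X → X`: the join of the pullbacks of
`𝒰` by the maps `σ s`, `s ∈ F`, consisting of all intersections `⋂_{s ∈ F} (σ s)⁻¹ U_s`
over choices `U_s ∈ 𝒰`. -/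
noncomputable def jointCoverOf {Γ X : Type*} (σ : Γ → X → X)
    (F : Finset Γ) (𝒰 : Finset (Set X)) : Finset (Set X) := by
  classical
  exact (F.pi fun _ => 𝒰).image fun ω => ⋂ s : Γ, ⋂ h : s ∈ F, σ s ⁻¹' ω s h

/-- The naive topological entropy `sup_𝒰 inf_F (1/|F|) log N(𝒰^F)` of the action
`σ : Γ → X → X`, where `𝒰` ranges over finite open covers of `X` and `F` over nonempty
finite subsets of `Γ`, as an extended nonnegative real. -/
noncomputable def naiveEntropyOf {Γ X : Type*} [TopologicalSpace X] (σ : Γ → X → X) :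
    ℝ≥0∞ :=
  ⨆ 𝒰 : {𝒰 : Finset (Set X) // IsFinOpenCover 𝒰},
    ⨅ F : {F : Finset Γ // F.Nonempty},
      ENNReal.ofReal (Real.log (coverNum (jointCoverOf σ F.1 𝒰.1) : ℝ) / (F.1.card : ℝ))

/-- A finite set of points, no two of which lie in a common member of the cover `𝒰`, has at most
`coverNum 𝒰` elements. -/
theorem card_le_coverNum {X ι : Type*} {𝒰 : Finset (Set X)}
    (hcover : ⋃₀ (𝒰 : Set (Set X)) = Set.univ) (A : Finset ι) (x : ι → X)
    (hsep : ∀ V ∈ 𝒰, ∀ i ∈ A, ∀ j ∈ A, x i ∈ V → x j ∈ V → i = j) :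
    A.card ≤ coverNum 𝒰 := by
  have hne : {n | ∃ 𝒱 : Finset (Set X), 𝒱 ⊆ 𝒰 ∧ ⋃₀ (𝒱 : Set (Set X)) = Set.univ ∧
      𝒱.card = n}.Nonempty := ⟨𝒰.card, 𝒰, subset_rfl, hcover, rfl⟩
  obtain ⟨𝒱, hsub, hunion, hcard⟩ := Nat.sInf_mem hne
  have hmem (i : ι) : ∃ V ∈ 𝒱, x i ∈ V := by
    have h : x i ∈ ⋃₀ (𝒱 : Set (Set X)) := hunion ▸ Set.mem_univ _
    simpa using h
  choose V hV hxV using hmem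
  refine (Finset.card_le_card_of_injOn V (fun i _ => hV i) ?_).trans hcard.le
  intro i hi j hj hij
  exact hsep (V i) (hsub (hV i)) i hi j hj (hxV i) (hij ▸ hxV j)

theorem mem_jointCoverOf {Γ X : Type*} {σ : Γ → X → X} {F : Finset Γ} {𝒰 : Finset (Set X)}
    {V : Set X} :
    V ∈ jointCoverOf σ F 𝒰 ↔ ∃ ω : ∀ s ∈ F, Set X, (∀ s h, ω s h ∈ 𝒰) ∧
      ⋂ s : Γ, ⋂ h : s ∈ F, σ s ⁻¹' ω s h = V := by
  simp [jointCoverOf, Finset.mem_pi]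

theorem sUnion_jointCoverOf {Γ X : Type*} (σ : Γ → X → X) (F : Finset Γ) {𝒰 : Finset (Set X)}
    (hcover : ⋃₀ (𝒰 : Set (Set X)) = Set.univ) :
    ⋃₀ (jointCoverOf σ F 𝒰 : Set (Set X)) = Set.univ := by
  refine Set.eq_univ_of_forall fun x => ?_
  have hmem (s : Γ) : ∃ U ∈ 𝒰, σ s x ∈ U := by
    have h : σ s x ∈ ⋃₀ (𝒰 : Set (Set X)) := hcover ▸ Set.mem_univ _
    simpa using h
  choose U hU hxU using hmem
  refine ⟨_, mem_jointCoverOf.2 ⟨fun s _ => U s, fun s _ => hU s, rfl⟩, ?_⟩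
  simpa using fun s _ => hxU s

/-- The cover of `Γ → Y` by the two sets on which the coordinate at `1` avoids `a`, respectively
`b`. -/
noncomputable def avoidingCover (Γ : Type*) [One Γ] {Y : Type*} (a b : Y) :
    Finset (Set (Γ → Y)) := by
  classical
  exact {{x | x 1 ≠ a}, {x | x 1 ≠ b}}

theorem mem_avoidingCover {Γ : Type*} [One Γ] {Y : Type*} {a b : Y} {U : Set (Γ → Y)} :
    U ∈ avoidingCover Γ a b ↔ U = {x | x 1 ≠ a} ∨ U = {x | x 1 ≠ b} := by
  simp [avoidingCover]

theorem isFinOpenCover_avoidingCover (Γ : Type*) [One Γ] {Y : Type*} [TopologicalSpace Y]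
    [T1Space Y] {a b : Y} (hab : a ≠ b) : IsFinOpenCover (avoidingCover Γ a b) := by
  have hopen (c : Y) : IsOpen {x : Γ → Y | x 1 ≠ c} :=
    isOpen_compl_singleton.preimage (continuous_apply 1)
  refine ⟨fun U hU => ?_, Set.eq_univ_of_forall fun x => ?_⟩
  · rcases mem_avoidingCover.1 hU with rfl | rfl
    exacts [hopen a, hopen b]
  · by_cases hx : x 1 = a
    · exact ⟨_, mem_avoidingCover.2 (.inr rfl), fun hb => hab (hx.symm.trans hb)⟩
    · exact ⟨_, mem_avoidingCover.2 (.inl rfl), hx⟩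

theorem two_pow_card_le_coverNum_shift {Γ Y : Type*} [Group Γ] [TopologicalSpace Y] [T1Space Y]
    {a b : Y} (hab : a ≠ b) (F : Finset Γ) :
    2 ^ F.card ≤ coverNum (jointCoverOf
      (fun (s : Γ) (x : Γ → Y) (t : Γ) => x (s⁻¹ * t)) F (avoidingCover Γ a b)) := by
  classical
  rw [← Finset.card_powerset]
  refine card_le_coverNum (sUnion_jointCoverOf _ F (isFinOpenCover_avoidingCover Γ hab).2)
    F.powerset (fun S t => if t⁻¹ ∈ S then a else b) fun V hV S hS T hT hxS hxT => ?_
  obtain ⟨ω, hω, rfl⟩ := mem_jointCoverOf.1 hV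
  simp only [Set.mem_iInter, Set.mem_preimage] at hxS hxT
  rw [Finset.mem_powerset] at hS hT
  ext s
  by_cases hs : s ∈ F
  · have h₁ := hxS s hs
    have h₂ := hxT s hs
    rcases mem_avoidingCover.1 (hω s hs) with h | h <;> rw [h] at h₁ h₂ <;> simp at h₁ h₂ <;> tauto
  · exact iff_of_false (fun h => hs (hS h)) (fun h => hs (hT h))

theorem log_two_le_naiveEntropyOf_shift {Γ Y : Type*} [Group Γ] [TopologicalSpace Y] [T1Space Y]
    [Nontrivial Y] :
    ENNReal.ofReal (Real.log 2) ≤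
      naiveEntropyOf (fun (s : Γ) (x : Γ → Y) (t : Γ) => x (s⁻¹ * t)) := by
  obtain ⟨a, b, hab⟩ := exists_pair_ne Y
  refine le_iSup_of_le ⟨avoidingCover Γ a b, isFinOpenCover_avoidingCover Γ hab⟩
    (le_iInf fun F => ENNReal.ofReal_le_ofReal ?_)
  rw [le_div_iff₀ (by exact_mod_cast F.2.card_pos), mul_comm, ← Real.log_pow]
  exact Real.log_le_log (by positivity) (by exact_mod_cast two_pow_card_le_coverNum_shift hab F.1)

/-- Let `Γ` be a countably infinite group acting on `(ℝ/ℤ)^Γ` by the left shift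
`(sx)_t = x_{s⁻¹t}`. Then the naive topological entropy of this action is positive. -/
theorem full_shift_positive_naive_entropy
    {Γ : Type*} [Group Γ] [Countable Γ] [Infinite Γ] :
    0 < naiveEntropyOf
        (fun (s : Γ) (x : Γ → UnitAddCircle) (t : Γ) => x (s⁻¹ * t)) := by
  have : Nontrivial UnitAddCircle := by
    refine ⟨((1 / 2 : ℝ) : UnitAddCircle), 0, fun h => ?_⟩
    obtain ⟨n, hn⟩ := (AddCircle.coe_eq_zero_iff (1 : ℝ)).1 h
    have h₂ : (2 * n : ℤ) = 1 := by
      have h₃ : (n : ℝ) = 1 / 2 := by simpa using hn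
      have : (2 * n : ℝ) = 1 := by linarith
      exact_mod_cast this
    omega
  exact (ENNReal.ofReal_pos.2 (Real.log_pos one_lt_two)).trans_le log_two_le_naiveEntropyOf_shift
end
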